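/- arXiv:math-ph/0203019 — 3 statements merged into one kernel-verified Lean document; each statement's English description precedes it below -/
import Mathlib

section
/- Let X, Y be bounded self-adjoint operators with X - Y trace class, and t > 0. Then f_t(X) - f_t(Y) is trace class with ||f_t(X) - f_t(Y)||_1 ≤ 3(1 + t^{-1})||X - Y||_1, where f_t(λ) = (1+t)λ^3/(1+tλ^2). -/
open scoped InnerProductSpace
open ContinuousLinearMap in
/-- Sum over a Hilbert basis of `⟨e i, |T|^p (e i)⟩`, where `|T|^p = (T†T)^{p/2}`
is defined by the continuous functional calculus. -/
noncomputable def schattenSum {H : Type*} [NormedAddCommGroup H] [InnerProductSpace ℂ H]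
    [CompleteSpace H] {ι : Type*} (b : HilbertBasis ι ℂ H) (p : ℝ) (T : H →L[ℂ] H) : ℝ :=
  ∑' i, (⟪b i, (cfc (fun x : ℝ => x ^ (p / 2)) (adjoint T * T)) (b i)⟫_ℂ).re

open ContinuousLinearMap in
/-- `T` belongs to the Schatten ideal `J_p` (w.r.t. the basis `b`). -/
def MemSchatten {H : Type*} [NormedAddCommGroup H] [InnerProductSpace ℂ H]
    [CompleteSpace H] {ι : Type*} (b : HilbertBasis ι ℂ H) (p : ℝ) (T : H →L[ℂ] H) : Prop :=
  Summable fun i => (⟪b i, (cfc (fun x : ℝ => x ^ (p / 2)) (adjoint T * T)) (b i)⟫_ℂ).re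

/-- The Schatten `p`-norm. -/
noncomputable def schattenNorm {H : Type*} [NormedAddCommGroup H] [InnerProductSpace ℂ H]
    [CompleteSpace H] {ι : Type*} (b : HilbertBasis ι ℂ H) (p : ℝ) (T : H →L[ℂ] H) : ℝ :=
  (schattenSum b p T) ^ (1 / p)

/-- The trace, evaluated in the Hilbert basis `b`. -/
noncomputable def traceB {H : Type*} [NormedAddCommGroup H] [InnerProductSpace ℂ H]
    [CompleteSpace H] {ι : Type*} (b : HilbertBasis ι ℂ H) (T : H →L[ℂ] H) : ℂ :=
  ∑' i, ⟪b i, T (b i)⟫_ℂ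
open ContinuousLinearMap

section helpers
variable {H : Type*} [NormedAddCommGroup H] [InnerProductSpace ℂ H] [CompleteSpace H]

theorem aux_mul_apply (A B : H →L[ℂ] H) (x : H) : (A * B) x = A (B x) := rfl

theorem aux_one_apply (x : H) : (1 : H →L[ℂ] H) x = x := rfl

theorem le_of_sq_le_sq_aux {a c : ℝ} (h : a ^ 2 ≤ c ^ 2) (hc : 0 ≤ c) : a ≤ c :=
  (le_abs_self a).trans (abs_le_of_sq_le_sq h hc)

theorem aux_abs (T : H →L[ℂ] H) :
    0 ≤ cfc (fun x : ℝ => x ^ ((1:ℝ) / 2)) (adjoint T * T) ∧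
    cfc (fun x : ℝ => x ^ ((1:ℝ) / 2)) (adjoint T * T) *
      cfc (fun x : ℝ => x ^ ((1:ℝ) / 2)) (adjoint T * T) = adjoint T * T := by
  have hT : 0 ≤ adjoint T * T := by
    have := star_mul_self_nonneg T
    rwa [star_eq_adjoint] at this
  have hsp : ∀ x ∈ spectrum ℝ (adjoint T * T), 0 ≤ x := fun x hx => spectrum_nonneg_of_nonneg hT hx
  have hc : ContinuousOn (fun x : ℝ => x ^ ((1:ℝ) / 2)) (spectrum ℝ (adjoint T * T)) :=
    (Real.continuous_rpow_const (by norm_num)).continuousOn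
  refine ⟨cfc_nonneg fun x hx => Real.rpow_nonneg (hsp x hx) _, ?_⟩
  rw [← cfc_mul _ _ _ hc hc]
  have hsa : IsSelfAdjoint (adjoint T * T) := IsSelfAdjoint.of_nonneg hT
  conv_rhs => rw [← cfc_id ℝ (adjoint T * T) hsa]
  refine cfc_congr fun x hx => ?_
  have := hsp x hx
  simp only [id]
  rw [← Real.sqrt_eq_rpow, Real.mul_self_sqrt this]

/-- an everywhere lower bounded by identity self-adjoint operator is a unit -/
theorem aux_unit (P : H →L[ℂ] H) (hP : 0 ≤ P) (e : ℝ) (he : 0 < e) :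
    IsUnit (P + (e : ℂ) • (1 : H →L[ℂ] H)) := by
  have h : -e ∉ spectrum ℝ P := fun h => by
    have := spectrum_nonneg_of_nonneg hP h
    linarith
  rw [spectrum.notMem_iff] at h
  have h2 := h.neg
  convert h2 using 1
  rw [Algebra.algebraMap_eq_smul_one]
  ext x
  simp [add_comm]

theorem aux_pos_norm (P : H →L[ℂ] H) (hP : 0 ≤ P) (e : ℝ) (he : 0 < e) (x : H) :
    ‖P x‖ ≤ ‖(P + (e : ℂ) • (1 : H →L[ℂ] H)) x‖ := by
  have h1 : 0 ≤ (⟪P x, x⟫_ℂ).re := by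
    have := ((nonneg_iff_isPositive P).1 hP).re_inner_nonneg_left x
    simpa using this
  have h2 : ‖P x + (e:ℂ) • x‖ ^ 2 = ‖P x‖ ^ 2 + 2 * (e * (⟪P x, x⟫_ℂ).re) + ‖(e:ℂ) • x‖ ^ 2 := by
    rw [@norm_add_sq ℂ, inner_smul_right]
    simp only [RCLike.re_to_complex, Complex.re_ofReal_mul]
  simp only [add_apply, smul_apply, aux_one_apply]
  refine le_of_sq_le_sq_aux ?_ (norm_nonneg _)
  rw [h2]
  have := mul_nonneg he.le h1
  have := sq_nonneg ‖(e:ℂ) • x‖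
  linarith

/-- approximate polar decomposition -/
theorem aux_polar (T P : H →L[ℂ] H) (hP : 0 ≤ P) (hPP : P * P = adjoint T * T)
    (e : ℝ) (he : 0 < e) :
    ∃ V : H →L[ℂ] H, ‖V‖ ≤ 1 ∧ ‖T - V * P‖ ≤ e ∧ ‖P - adjoint V * T‖ ≤ e := by
  obtain ⟨u, hu⟩ := aux_unit P hP e he
  set Q : H →L[ℂ] H := ↑u⁻¹ with hQ
  have hPsa : adjoint P = P := (IsSelfAdjoint.of_nonneg hP).adjoint_eq
  have hA : adjoint (P + (e : ℂ) • (1 : H →L[ℂ] H)) = P + (e : ℂ) • (1 : H →L[ℂ] H) := by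
    simp [← star_eq_adjoint, star_add, star_smul]
    rw [star_eq_adjoint, hPsa]
  have h1 : (P + (e : ℂ) • (1 : H →L[ℂ] H)) * Q = 1 := by rw [← hu]; simp [hQ]
  have h2 : Q * (P + (e : ℂ) • (1 : H →L[ℂ] H)) = 1 := by rw [← hu]; simp [hQ]
  have h1' : P * Q = 1 - (e:ℂ) • Q := by
    rw [add_mul, smul_mul_assoc, one_mul] at h1
    rw [← h1]; abel
  have h2' : Q * P = 1 - (e:ℂ) • Q := by
    rw [mul_add, mul_smul_comm, mul_one] at h2
    rw [← h2]; abel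
  have hQsa : adjoint Q = Q := by
    have h3 : adjoint Q * (P + (e : ℂ) • (1 : H →L[ℂ] H)) = 1 := by
      have := congrArg star h1
      rw [star_mul, star_one, star_eq_adjoint, star_eq_adjoint, hA] at this
      exact this
    calc adjoint Q = adjoint Q * ((P + (e : ℂ) • (1 : H →L[ℂ] H)) * Q) := by rw [h1, mul_one]
      _ = Q := by rw [← mul_assoc, h3, one_mul]
  have hPQ : ‖P * Q‖ ≤ 1 := by
    refine opNorm_le_bound _ zero_le_one fun x => ?_
    have := aux_pos_norm P hP e he (Q x)
    have h4 : (P + (e : ℂ) • (1 : H →L[ℂ] H)) (Q x) = x := congrArg (fun A => A x) h1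
    rw [h4] at this
    simpa using this
  have hTP : ∀ x, ‖T x‖ = ‖P x‖ := by
    intro x
    have : ‖T x‖ ^ 2 = ‖P x‖ ^ 2 := by
      have e1 : ⟪T x, T x⟫_ℂ = ⟪P x, P x⟫_ℂ := by
        rw [← adjoint_inner_left, ← adjoint_inner_left P, hPsa]
        have := congrArg (fun A => A x) hPP
        simp only [aux_mul_apply] at this
        rw [this]
      rw [inner_self_eq_norm_sq_to_K, inner_self_eq_norm_sq_to_K] at e1
      exact_mod_cast e1
    exact (sq_eq_sq₀ (norm_nonneg _) (norm_nonneg _)).1 this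
  have hV : ‖T * Q‖ ≤ 1 := by
    refine opNorm_le_bound _ zero_le_one fun x => ?_
    have := (P * Q).le_of_opNorm_le hPQ x
    simp only [aux_mul_apply] at this ⊢
    rwa [hTP]
  have hen : ‖(e:ℂ)‖ = e := by simp [abs_of_pos he]
  refine ⟨T * Q, hV, ?_, ?_⟩
  · have : T - T * Q * P = (e:ℂ) • (T * Q) := by
      rw [mul_assoc, h2', mul_sub, mul_one, mul_smul_comm]; abel
    rw [this, norm_smul, hen]
    nlinarith
  · have : P - adjoint (T * Q) * T = (e:ℂ) • (P * Q) := by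
      have : adjoint (T * Q) = Q * adjoint T := by
        rw [← star_eq_adjoint, star_mul, star_eq_adjoint, star_eq_adjoint, hQsa]
      rw [this, mul_assoc, ← hPP, ← mul_assoc, h2', sub_mul, one_mul, smul_mul_assoc, h2', h1']; abel
    rw [this, norm_smul, hen]
    nlinarith

variable {ι : Type*}

open scoped ENNReal in
theorem aux_parseval (b : HilbertBasis ι ℂ H) (x : H) :
    ∑' i, ‖⟪b i, x⟫_ℂ‖ₑ ^ 2 = ‖x‖ₑ ^ 2 := by
  have h := b.hasSum_inner_mul_inner x x
  have h2 : HasSum (fun i => ‖⟪b i, x⟫_ℂ‖ ^ 2) (‖x‖ ^ 2) := by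
    have := (Complex.reCLM.hasSum h)
    convert this using 1
    · ext i
      simp only [Function.comp, Complex.reCLM_apply]
      rw [← inner_conj_symm x (b i), RCLike.conj_mul]
      norm_cast
    · rw [inner_self_eq_norm_sq_to_K]
      simp only [Complex.reCLM_apply]
      norm_cast
  have h3 := ENNReal.ofReal_tsum_of_nonneg (fun i => by positivity) h2.summable
  rw [h2.tsum_eq] at h3
  simp only [ENNReal.ofReal_pow (norm_nonneg _), ofReal_norm] at h3
  exact h3.symm

theorem aux_hs_adj (b : HilbertBasis ι ℂ H) (R : H →L[ℂ] H) :
    ∑' i, ‖adjoint R (b i)‖ₑ ^ 2 = ∑' i, ‖R (b i)‖ₑ ^ 2 := by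
  simp_rw [← aux_parseval b (R _), ← aux_parseval b (adjoint R _)]
  rw [ENNReal.tsum_comm]
  refine tsum_congr fun i => tsum_congr fun j => ?_
  rw [adjoint_inner_right, ← inner_conj_symm, RCLike.enorm_conj]

theorem aux_hs_left (b : HilbertBasis ι ℂ H) (A R : H →L[ℂ] H) (hA : ‖A‖ ≤ 1) :
    ∑' i, ‖A (R (b i))‖ₑ ^ 2 ≤ ∑' i, ‖R (b i)‖ₑ ^ 2 := by
  refine ENNReal.tsum_le_tsum fun i => ?_
  gcongr
  rw [enorm_le_iff_norm_le]
  simpa using A.le_of_opNorm_le hA (R (b i))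

theorem aux_hs_right (b : HilbertBasis ι ℂ H) (A R : H →L[ℂ] H) (hA : ‖A‖ ≤ 1) :
    ∑' i, ‖R (A (b i))‖ₑ ^ 2 ≤ ∑' i, ‖R (b i)‖ₑ ^ 2 := by
  have h1 := aux_hs_adj b (R * A)
  rw [← aux_hs_adj b R]
  have h2 := aux_hs_left b (adjoint A) (adjoint R) (by rwa [LinearIsometryEquiv.norm_map])
  refine le_trans (le_of_eq ?_) h2
  rw [← star_eq_adjoint, star_mul] at h1
  simpa [star_eq_adjoint] using h1.symm

theorem aux_hs_real (b : HilbertBasis ι ℂ H) (A R : H →L[ℂ] H) (hA : ‖A‖ ≤ 1)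
    (hR : Summable fun i => ‖R (b i)‖ ^ 2) (F : Finset ι) :
    ∑ i ∈ F, ‖R (A (b i))‖ ^ 2 ≤ ∑' i, ‖R (b i)‖ ^ 2 := by
  have h := aux_hs_right b A R hA
  have h3 := ENNReal.ofReal_tsum_of_nonneg (fun i => by positivity) hR
  simp only [ENNReal.ofReal_pow (norm_nonneg _), ofReal_norm] at h3
  rw [← h3] at h
  have h4 := (ENNReal.sum_le_tsum F).trans h
  rw [← ENNReal.ofReal_le_ofReal_iff (tsum_nonneg fun i => by positivity),
    ENNReal.ofReal_sum_of_nonneg (fun i _ => by positivity)]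
  simpa only [ENNReal.ofReal_pow (norm_nonneg _), ofReal_norm] using h4

theorem aux_pair (b : HilbertBasis ι ℂ H) (T P C B : H →L[ℂ] H) (hP : 0 ≤ P)
    (hPP : P * P = adjoint T * T) (hC : ‖C‖ ≤ 1) (hB : ‖B‖ ≤ 1)
    (hs : Summable fun i => (⟪b i, P (b i)⟫_ℂ).re) (F : Finset ι) :
    ∑ i ∈ F, ‖⟪C (b i), T (B (b i))⟫_ℂ‖ ≤ ∑' i, (⟪b i, P (b i)⟫_ℂ).re := by
  set R := CFC.sqrt P with hRdef
  have hR0 : 0 ≤ R := CFC.sqrt_nonneg P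
  have hRsa : adjoint R = R := (IsSelfAdjoint.of_nonneg hR0).adjoint_eq
  have hRR : R * R = P := CFC.sqrt_mul_sqrt_self P hP
  have hRn : ∀ i, (⟪b i, P (b i)⟫_ℂ).re = ‖R (b i)‖ ^ 2 := by
    intro i
    rw [← hRR, aux_mul_apply, ← adjoint_inner_left, hRsa, inner_self_eq_norm_sq_to_K]
    norm_cast
  simp_rw [hRn] at hs ⊢
  refine le_of_forall_pos_le_add fun d hd => ?_
  have hF : (0:ℝ) < F.card + 1 := by positivity
  obtain ⟨V, hV, hTV, -⟩ := aux_polar T P hP hPP (d / (F.card + 1)) (by positivity)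
  have hD : ‖adjoint V * C‖ ≤ 1 := by
    refine (norm_mul_le _ _).trans ?_
    rw [LinearIsometryEquiv.norm_map]
    exact mul_le_one₀ hV (norm_nonneg _) hC
  have key : ∀ i, ‖⟪C (b i), T (B (b i))⟫_ℂ‖ ≤
      (1/2) * ‖R ((adjoint V * C) (b i))‖ ^ 2 + (1/2) * ‖R (B (b i))‖ ^ 2 + d / (F.card + 1) := by
    intro i
    have hbi : ‖b i‖ = 1 := b.orthonormal.1 i
    have e1 : ⟪C (b i), T (B (b i))⟫_ℂ = ⟪R ((adjoint V * C) (b i)), R (B (b i))⟫_ℂ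
        + ⟪C (b i), (T - V * P) (B (b i))⟫_ℂ := by
      rw [← hRsa, adjoint_inner_left, hRsa, aux_mul_apply, adjoint_inner_left, ← inner_add_right]
      congr 1
      rw [← hRR]
      simp
    rw [e1]
    refine (norm_add_le _ _).trans (add_le_add ?_ ?_)
    · refine (norm_inner_le_norm _ _).trans ?_
      nlinarith [sq_nonneg (‖R ((adjoint V * C) (b i))‖ - ‖R (B (b i))‖)]
    · refine (norm_inner_le_norm _ _).trans ?_
      have a1 := C.le_of_opNorm_le hC (b i)
      have a2 := B.le_of_opNorm_le hB (b i)
      have a3 := (T - V * P).le_of_opNorm_le hTV (B (b i))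
      rw [hbi] at a1 a2
      have hpos : 0 ≤ d / ((F.card:ℝ) + 1) := by positivity
      have a4 : ‖(T - V * P) (B (b i))‖ ≤ d / ((F.card:ℝ) + 1) := by
        refine a3.trans ?_
        nlinarith
      nlinarith [norm_nonneg ((T - V * P) (B (b i))), norm_nonneg (C (b i))]
  refine (Finset.sum_le_sum fun i _ => key i).trans ?_
  rw [Finset.sum_add_distrib, Finset.sum_add_distrib, ← Finset.mul_sum, ← Finset.mul_sum]
  have k1 := aux_hs_real b _ R hD hs F
  have k2 := aux_hs_real b _ R hB hs F
  have k3 : ∑ i ∈ F, d / ((F.card:ℝ) + 1) ≤ d := by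
    rw [Finset.sum_const, nsmul_eq_mul, ← mul_div_assoc, div_le_iff₀ hF]
    nlinarith
  linarith

theorem aux_inv (X : H →L[ℂ] H) (hX : IsSelfAdjoint X) (t : ℝ) (ht : 0 < t) :
    ∃ A : H →L[ℂ] H, Ring.inverse (1 + ((t : ℂ)) • X ^ 2) = A ∧
      A * (1 + ((t : ℂ)) • X ^ 2) = 1 ∧ (1 + ((t : ℂ)) • X ^ 2) * A = 1 ∧ X * A = A * X ∧
      ‖A‖ ≤ 1 ∧ ‖((√t : ℝ) : ℂ) • (X * A)‖ ≤ 1 := by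
  have hsa : adjoint X = X := hX.adjoint_eq
  have hpos : 0 ≤ (t:ℂ) • X ^ 2 := by
    have h := star_mul_self_nonneg X
    rw [hX.star_eq] at h
    rw [pow_two]
    have := smul_nonneg ht.le h
    convert this using 1
    ext x
    simp
  have hu : IsUnit (1 + ((t : ℂ)) • X ^ 2) := by
    have := aux_unit _ hpos 1 one_pos
    rw [add_comm]
    simpa using this
  have l1 := Ring.inverse_mul_cancel _ hu
  have l2 := Ring.mul_inverse_cancel _ hu
  set A := Ring.inverse (1 + ((t : ℂ)) • X ^ 2) with hA
  have hcomm : X * A = A * X := by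
    have c : Commute X (1 + ((t : ℂ)) • X ^ 2) :=
      (Commute.one_right X).add_right (((Commute.refl X).pow_right 2).smul_right _)
    calc X * A = A * (1 + ((t : ℂ)) • X ^ 2) * (X * A) := by rw [l1, one_mul]
      _ = A * ((1 + ((t : ℂ)) • X ^ 2) * X) * A := by simp only [mul_assoc]
      _ = A * (X * (1 + ((t : ℂ)) • X ^ 2)) * A := by rw [c.eq]
      _ = A * X * ((1 + ((t : ℂ)) • X ^ 2) * A) := by simp only [mul_assoc]
      _ = A * X := by rw [l2, mul_one]
  have hn : ∀ y, ‖y‖ ^ 2 + 2 * (t * ‖X y‖ ^ 2) ≤ ‖(1 + ((t : ℂ)) • X ^ 2 : H →L[ℂ] H) y‖ ^ 2 := by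
    intro y
    have e1 : (1 + ((t : ℂ)) • X ^ 2 : H →L[ℂ] H) y = y + (t:ℂ) • X (X y) := by simp [pow_two]
    have e2 : ⟪y, X (X y)⟫_ℂ = (‖X y‖:ℂ) ^ 2 := by
      rw [← adjoint_inner_left, hsa, inner_self_eq_norm_sq_to_K]; rfl
    rw [e1, @norm_add_sq ℂ, inner_smul_right, e2]
    have : RCLike.re ((t:ℂ) * (‖X y‖:ℂ) ^ 2) = t * ‖X y‖ ^ 2 := by
      simp only [RCLike.re_to_complex]
      norm_cast
    rw [this]
    have := sq_nonneg ‖(t:ℂ) • X (X y)‖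
    linarith
  have hAx : ∀ x, (1 + ((t : ℂ)) • X ^ 2 : H →L[ℂ] H) (A x) = x := fun x => congrArg (fun A => A x) l2
  refine ⟨A, rfl, l1, l2, hcomm, ?_, ?_⟩
  · refine opNorm_le_bound _ zero_le_one fun x => ?_
    have := hn (A x)
    rw [hAx] at this
    rw [one_mul]
    refine le_of_sq_le_sq_aux ?_ (norm_nonneg _)
    have h3 : 0 ≤ t * ‖X (A x)‖ ^ 2 := by positivity
    linarith
  · refine opNorm_le_bound _ zero_le_one fun x => ?_
    have := hn (A x)
    rw [hAx] at this
    rw [one_mul]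
    refine le_of_sq_le_sq_aux ?_ (norm_nonneg _)
    have h3 : 0 ≤ t * ‖X (A x)‖ ^ 2 := by positivity
    have h4 : ‖(((√t : ℝ) : ℂ) • (X * A)) x‖ ^ 2 = t * ‖X (A x)‖ ^ 2 := by
      rw [smul_apply, norm_smul, mul_pow, aux_mul_apply]
      congr 1
      rw [Complex.norm_real, Real.norm_eq_abs, sq_abs, Real.sq_sqrt ht.le]
    rw [h4]
    have := sq_nonneg ‖A x‖
    linarith

theorem aux_ident (X Y A B : H →L[ℂ] H) (t : ℂ) (ht : t ≠ 0)
    (hA : A * (1 + t • X ^ 2) = 1) (hA2 : (1 + t • X ^ 2) * A = 1) (hB : (1 + t • Y ^ 2) * B = 1)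
    (hXA : X * A = A * X) (hYB : Y * B = B * Y) :
    (1 + t) • (X ^ 3 * A) - (1 + t) • (Y ^ 3 * B) =
      (1 + t⁻¹) • ((X - Y) - A * (X - Y) * B + t • ((X * A) * (X - Y) * (Y * B))) := by
  have g : ∀ Z C : H →L[ℂ] H, (1 + t • Z ^ 2) * C = 1 →
      (1 + t) • (Z ^ 3 * C) = (1 + t⁻¹) • (Z - Z * C) := by
    intro Z C h
    have h1 : Z - Z * C = t • (Z ^ 3 * C) := by
      have : Z * ((1 + t • Z ^ 2) * C) = Z := by rw [h, mul_one]
      rw [add_mul, mul_add, one_mul, smul_mul_assoc, mul_smul_comm, ← mul_assoc, ← pow_succ'] at this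
      nth_rewrite 1 [← this]
      abel
    rw [h1, smul_smul]
    congr 1
    field_simp
    ring
  rw [g X A hA2, g Y B hB, ← smul_sub]
  congr 1
  have h1 : X * A = A * X * ((1 + t • Y ^ 2) * B) := by rw [hB, mul_one, hXA]
  have h2 : Y * B = A * (1 + t • X ^ 2) * (Y * B) := by rw [hA, one_mul]
  have h3 : X * A - Y * B = A * (X - Y) * B - t • ((X * A) * (X - Y) * (Y * B)) := by
    rw [h1]
    nth_rewrite 1 [h2]
    rw [hB, mul_one]
    have h1 : A * X = A * X * ((1 + t • Y ^ 2) * B) := by rw [hB, mul_one]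
    nth_rewrite 1 [h1]
    simp only [mul_add, add_mul, mul_sub, sub_mul, smul_mul_assoc, mul_smul_comm, mul_one, one_mul,
      pow_two, mul_assoc, smul_sub]
    abel
  rw [sub_sub_sub_comm, h3]
  abel

end helpers

theorem stmt9 {H : Type*} [NormedAddCommGroup H] [InnerProductSpace ℂ H] [CompleteSpace H]
    {ι : Type*} (b : HilbertBasis ι ℂ H) (X Y : H →L[ℂ] H)
    (hX : IsSelfAdjoint X) (hY : IsSelfAdjoint Y) (h1 : MemSchatten b 1 (X - Y))
    (t : ℝ) (ht : 0 < t) :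
    MemSchatten b 1
        (((1 + t : ℝ) : ℂ) • (X ^ 3 * Ring.inverse (1 + ((t : ℂ)) • X ^ 2))
          - ((1 + t : ℝ) : ℂ) • (Y ^ 3 * Ring.inverse (1 + ((t : ℂ)) • Y ^ 2))) ∧
    schattenNorm b 1
        (((1 + t : ℝ) : ℂ) • (X ^ 3 * Ring.inverse (1 + ((t : ℂ)) • X ^ 2))
          - ((1 + t : ℝ) : ℂ) • (Y ^ 3 * Ring.inverse (1 + ((t : ℂ)) • Y ^ 2))) ≤
      3 * (1 + t⁻¹) * schattenNorm b 1 (X - Y) := by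
  obtain ⟨A, hA, hA1, hA2, hXA, hAn, hXAn⟩ := aux_inv X hX t ht
  obtain ⟨B, hB, hB1, hB2, hYB, hBn, hYBn⟩ := aux_inv Y hY t ht
  rw [hA, hB]
  have hid := aux_ident X Y A B (t:ℂ) (by exact_mod_cast ht.ne') hA1 hA2 hB2 hXA hYB
  have hcast : ((1 + t : ℝ) : ℂ) = 1 + (t:ℂ) := by push_cast; rfl
  rw [hcast]
  set S := (1 + (t:ℂ)) • (X ^ 3 * A) - (1 + (t:ℂ)) • (Y ^ 3 * B) with hS
  set T := X - Y with hT
  obtain ⟨hP, hPP⟩ := aux_abs T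
  obtain ⟨hM, hMM⟩ := aux_abs S
  unfold MemSchatten at h1
  unfold MemSchatten schattenNorm schattenSum
  set P := cfc (fun x : ℝ => x ^ ((1:ℝ) / 2)) (adjoint T * T)
  set M := cfc (fun x : ℝ => x ^ ((1:ℝ) / 2)) (adjoint S * S)
  simp only [div_one, Real.rpow_one]
  set τ := ∑' i, (⟪b i, P (b i)⟫_ℂ).re with hτ
  clear_value τ P M S T
  have hM0 : ∀ i, 0 ≤ (⟪b i, M (b i)⟫_ℂ).re := fun i => by
    have := ((nonneg_iff_isPositive M).1 hM).re_inner_nonneg_right (b i)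
    simpa using this
  have ht1 : 0 < 1 + t⁻¹ := by positivity
  have main : ∀ F : Finset ι, ∑ i ∈ F, (⟪b i, M (b i)⟫_ℂ).re ≤ 3 * (1 + t⁻¹) * τ := by
    intro F
    refine le_of_forall_pos_le_add fun d hd => ?_
    have hF : (0:ℝ) < F.card + 1 := by positivity
    obtain ⟨U, hU, -, hUM⟩ := aux_polar S M hM hMM (d / (F.card + 1)) (by positivity)
    have hadj : ∀ C : H →L[ℂ] H, ‖C‖ ≤ 1 → ‖adjoint C * U‖ ≤ 1 := fun C hC => by
      refine (norm_mul_le _ _).trans ?_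
      rw [LinearIsometryEquiv.norm_map]
      exact mul_le_one₀ hC (norm_nonneg _) hU
    have p1 := aux_pair b T P U 1 hP hPP hU norm_id_le h1 F
    have p2 := aux_pair b T P _ B hP hPP (hadj A hAn) hBn h1 F
    have p3 := aux_pair b T P _ _ hP hPP (hadj _ hXAn) hYBn h1 F
    have key : ∀ i, (⟪b i, M (b i)⟫_ℂ).re ≤ (1 + t⁻¹) * (‖⟪U (b i), T ((1 : H →L[ℂ] H) (b i))⟫_ℂ‖
        + ‖⟪(adjoint A * U) (b i), T (B (b i))⟫_ℂ‖ +
        ‖⟪(adjoint (((√t : ℝ) : ℂ) • (X * A)) * U) (b i), T ((((√t : ℝ) : ℂ) • (Y * B)) (b i))⟫_ℂ‖)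
        + d / (F.card + 1) := by
      intro i
      have hbi : ‖b i‖ = 1 := b.orthonormal.1 i
      have hss : ((√t : ℝ) : ℂ) * ((√t : ℝ) : ℂ) = t := by
        rw [← Complex.ofReal_mul, Real.mul_self_sqrt ht.le]
      have e1 : ⟪b i, M (b i)⟫_ℂ = (1 + (t:ℂ)⁻¹) * (⟪U (b i), T ((1 : H →L[ℂ] H) (b i))⟫_ℂ
          - ⟪(adjoint A * U) (b i), T (B (b i))⟫_ℂ +
          ⟪(adjoint (((√t : ℝ) : ℂ) • (X * A)) * U) (b i),
            T ((((√t : ℝ) : ℂ) • (Y * B)) (b i))⟫_ℂ)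
          + ⟪b i, (M - adjoint U * S) (b i)⟫_ℂ := by
        rw [aux_mul_apply, aux_mul_apply, adjoint_inner_left, adjoint_inner_left, ← inner_sub_right,
          ← inner_add_right, ← inner_smul_right, sub_apply, inner_sub_right, aux_mul_apply,
          adjoint_inner_right, hid]
        have : (1 + (t:ℂ)⁻¹) • (T ((1 : H →L[ℂ] H) (b i)) - A (T (B (b i))) +
            (((√t : ℝ) : ℂ) • (X * A)) (T ((((√t : ℝ) : ℂ) • (Y * B)) (b i)))) =
            ((1 + (t:ℂ)⁻¹) • (T - A * T * B + (t:ℂ) • (X * A * T * (Y * B)))) (b i) := by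
          simp only [smul_apply, add_apply, sub_apply, aux_mul_apply, aux_one_apply, map_smul, smul_smul,
            hss]
        rw [this]
        ring
      refine (Complex.re_le_norm _).trans ?_
      rw [e1]
      refine (norm_add_le _ _).trans (add_le_add ?_ ?_)
      · rw [norm_mul]
        have : ‖1 + (t:ℂ)⁻¹‖ = 1 + t⁻¹ := by
          rw [← Complex.ofReal_inv, ← Complex.ofReal_one, ← Complex.ofReal_add, Complex.norm_real,
            Real.norm_of_nonneg ht1.le]
        rw [this]
        gcongr
        exact (norm_add_le _ _).trans (add_le_add_left (norm_sub_le _ _) _)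
      · refine (norm_inner_le_norm _ _).trans ?_
        have := (M - adjoint U * S).le_of_opNorm_le hUM (b i)
        rw [hbi] at this ⊢
        linarith
    refine (Finset.sum_le_sum fun i _ => key i).trans ?_
    rw [Finset.sum_add_distrib, ← Finset.mul_sum, Finset.sum_add_distrib, Finset.sum_add_distrib]
    have k3 : ∑ i ∈ F, d / ((F.card:ℝ) + 1) ≤ d := by
      rw [Finset.sum_const, nsmul_eq_mul, ← mul_div_assoc, div_le_iff₀ hF]
      nlinarith
    refine add_le_add ?_ k3
    rw [mul_comm 3, mul_assoc]
    refine mul_le_mul_of_nonneg_left ?_ ht1.le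
    linarith
  have hsum := summable_of_sum_le hM0 main
  exact ⟨hsum, hsum.tsum_le_of_sum_le main⟩
end

section
/- Let X, Y be bounded self-adjoint operators with X - Y trace class. Then lim_{t→∞} tr(f_t(X) - f_t(Y)) = tr(X - Y), where f_t(λ) = (1+t)λ^3/(1+tλ^2). -/
open scoped InnerProductSpace
open Filter Topology

section helpers
set_option linter.unusedSectionVars false
variable {H : Type*} [NormedAddCommGroup H] [InnerProductSpace ℂ H] [CompleteSpace H]
  {ι : Type*}

lemma sa_inner {A : H →L[ℂ] H} (hA : IsSelfAdjoint A) (x y : H) : ⟪A x, y⟫_ℂ = ⟪x, A y⟫_ℂ :=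
  (ContinuousLinearMap.isSelfAdjoint_iff_isSymmetric.mp hA) x y

lemma parseval_hasSum (b : HilbertBasis ι ℂ H) (x : H) :
    HasSum (fun i => ‖⟪b i, x⟫_ℂ‖ ^ 2) (‖x‖ ^ 2) := by
  have h := (b.hasSum_inner_mul_inner x x)
  have h2 := Complex.hasSum_re h
  convert h2 using 1
  · funext i
    rw [← inner_conj_symm x (b i), ← Complex.normSq_eq_conj_mul_self, Complex.ofReal_re,
      Complex.normSq_eq_norm_sq]
  · rw [inner_self_eq_norm_sq_to_K]
    norm_cast

lemma hs_summable (b : HilbertBasis ι ℂ H) (v : ι → H) (hv : Summable fun j => ‖v j‖ ^ 2) :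
    Summable fun q : ι × ι => ‖⟪b q.2, v q.1⟫_ℂ‖ ^ 2 := by
  rw [summable_prod_of_nonneg (fun q => by positivity)]
  refine ⟨fun j => (parseval_hasSum b (v j)).summable, ?_⟩
  simpa only [(parseval_hasSum b (v _)).tsum_eq] using hv

lemma hs_swap (b : HilbertBasis ι ℂ H) (v w : ι → H) (hv : Summable fun j => ‖v j‖ ^ 2)
    (hw : Summable fun j => ‖w j‖ ^ 2) (c : ι → ℂ)
    (hc : ∀ i, HasSum (fun j => ⟪w j, b i⟫_ℂ * ⟪b i, v j⟫_ℂ) (c i)) :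
    HasSum c (∑' j, ⟪w j, v j⟫_ℂ) := by
  have hs : Summable fun q : ι × ι => ⟪w q.1, b q.2⟫_ℂ * ⟪b q.2, v q.1⟫_ℂ := by
    refine Summable.of_norm_bounded ((hs_summable b v hv).add (hs_summable b w hw)) ?_
    intro q
    rw [norm_mul, norm_inner_symm]
    nlinarith [sq_nonneg (‖⟪b q.2, w q.1⟫_ℂ‖ - ‖⟪b q.2, v q.1⟫_ℂ‖),
      sq_nonneg (‖⟪b q.2, w q.1⟫_ℂ‖), sq_nonneg ‖⟪b q.2, v q.1⟫_ℂ‖]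
  have h1 : HasSum (fun j => ⟪w j, v j⟫_ℂ) _ :=
    hs.hasSum.prod_fiberwise (fun j => b.hasSum_inner_mul_inner (w j) (v j))
  have h2 := ((Equiv.prodComm ι ι).hasSum_iff.mpr hs.hasSum).prod_fiberwise hc
  rw [h1.tsum_eq]
  exact h2

lemma norm_sq_bound (A : H →L[ℂ] H) (v : ι → H) (hv : Summable fun j => ‖v j‖ ^ 2) :
    Summable fun j => ‖A (v j)‖ ^ 2 := by
  refine Summable.of_nonneg_of_le (fun j => by positivity) (fun j => ?_) (hv.mul_left (‖A‖ ^ 2))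
  rw [← mul_pow]
  exact pow_le_pow_left₀ (norm_nonneg _) (A.le_opNorm _) 2

lemma trace_cyc (b : HilbertBasis ι ℂ H) {P A B : H →L[ℂ] H} (hP : IsSelfAdjoint P)
    (hA : IsSelfAdjoint A) (hB : IsSelfAdjoint B) (hs : Summable fun j => ‖P (b j)‖ ^ 2) :
    HasSum (fun i => ⟪b i, (A * (P * P) * B) (b i)⟫_ℂ) (∑' j, ⟪B (P (b j)), A (P (b j))⟫_ℂ) := by
  refine hs_swap b _ _ (norm_sq_bound A _ hs) (norm_sq_bound B _ hs) _ fun i => ?_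
  have h := b.hasSum_inner_mul_inner (P (A (b i))) (P (B (b i)))
  have e1 : ⟪P (A (b i)), P (B (b i))⟫_ℂ = ⟪b i, (A * (P * P) * B) (b i)⟫_ℂ := by
    rw [sa_inner hP, sa_inner hA]; rfl
  have e2 : (fun j => ⟪P (A (b i)), b j⟫_ℂ * ⟪b j, P (B (b i))⟫_ℂ)
      = fun j => ⟪B (P (b j)), b i⟫_ℂ * ⟪b i, A (P (b j))⟫_ℂ := by
    funext j
    rw [mul_comm, sa_inner hP, sa_inner hA, sa_inner hB, sa_inner hP]
  rw [e1, e2] at h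
  exact h

lemma trace_lim (b : HilbertBasis ι ℂ H) {P : H →L[ℂ] H}
    (hs : Summable fun j => ‖P (b j)‖ ^ 2) {A B : ℝ → H →L[ℂ] H} {A0 B0 : H →L[ℂ] H}
    (hA : ∀ t > 0, ∀ x, ‖A t x‖ ≤ ‖x‖) (hB : ∀ t > 0, ∀ x, ‖B t x‖ ≤ ‖x‖)
    (hA0 : ∀ x, Tendsto (fun t => A t x) atTop (𝓝 (A0 x)))
    (hB0 : ∀ x, Tendsto (fun t => B t x) atTop (𝓝 (B0 x))) :
    Tendsto (fun t => ∑' j, ⟪B t (P (b j)), A t (P (b j))⟫_ℂ) atTop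
      (𝓝 (∑' j, ⟪B0 (P (b j)), A0 (P (b j))⟫_ℂ)) := by
  refine tendsto_tsum_of_dominated_convergence hs (fun j => (hB0 _).inner (hA0 _)) ?_
  filter_upwards [eventually_gt_atTop 0] with t ht j
  refine (norm_inner_le_norm _ _).trans ?_
  rw [sq]
  exact mul_le_mul (hB t ht _) (hA t ht _) (norm_nonneg _) (norm_nonneg _)

lemma decomp (b : HilbertBasis ι ℂ H) {D : H →L[ℂ] H} (hD : IsSelfAdjoint D)
    (h1 : MemSchatten b 1 D) : ∃ P Q : H →L[ℂ] H, IsSelfAdjoint P ∧ IsSelfAdjoint Q ∧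
      D = P * P - Q * Q ∧ (Summable fun j => ‖P (b j)‖ ^ 2) ∧ Summable fun j => ‖Q (b j)‖ ^ 2 := by
  have hP : IsSelfAdjoint (cfc (fun x : ℝ => √(max x 0)) D) := cfc_predicate _ _
  have hQ : IsSelfAdjoint (cfc (fun x : ℝ => √(max (-x) 0)) D) := cfc_predicate _ _
  have hPP : cfc (fun x : ℝ => √(max x 0)) D * cfc (fun x : ℝ => √(max x 0)) D
      = cfc (fun x : ℝ => max x 0) D := by
    rw [← cfc_mul _ _ D]
    congr 1; funext x; exact Real.mul_self_sqrt (le_max_right _ _)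
  have hQQ : cfc (fun x : ℝ => √(max (-x) 0)) D * cfc (fun x : ℝ => √(max (-x) 0)) D
      = cfc (fun x : ℝ => max (-x) 0) D := by
    rw [← cfc_mul _ _ D]
    congr 1; funext x; exact Real.mul_self_sqrt (le_max_right _ _)
  have habs : cfc (fun x : ℝ => x ^ ((1:ℝ) / 2)) (ContinuousLinearMap.adjoint D * D)
      = cfc (fun x : ℝ => max x 0) D + cfc (fun x : ℝ => max (-x) 0) D := by
    rw [← cfc_add D _ _, ← ContinuousLinearMap.star_eq_adjoint, hD.star_eq, ← sq]
    rw [← cfc_comp_pow (fun x : ℝ => x ^ ((1:ℝ) / 2)) 2 D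
      (by apply Continuous.continuousOn; exact Real.continuous_rpow_const (by norm_num))]
    congr 1; funext x
    rw [← Real.sqrt_eq_rpow, Real.sqrt_sq_eq_abs]
    rcases le_total 0 x with h | h
    · rw [abs_of_nonneg h, max_eq_left h, max_eq_right (by linarith)]; ring
    · rw [abs_of_nonpos h, max_eq_right h, max_eq_left (by linarith)]; ring
  have key : ∀ {P : H →L[ℂ] H}, IsSelfAdjoint P → ∀ x, (⟪x, (P * P) x⟫_ℂ).re = ‖P x‖ ^ 2 := by
    intro P hP x
    rw [mul_apply_eq_comp, ← sa_inner hP, inner_self_eq_norm_sq_to_K]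
    norm_cast
  have hsum : Summable fun j => ‖cfc (fun x : ℝ => √(max x 0)) D (b j)‖ ^ 2
      + ‖cfc (fun x : ℝ => √(max (-x) 0)) D (b j)‖ ^ 2 := by
    unfold MemSchatten at h1
    rw [habs, ← hPP, ← hQQ] at h1
    refine h1.congr fun j => ?_
    rw [add_apply, inner_add_right, Complex.add_re, key hP, key hQ]
  refine ⟨_, _, hP, hQ, ?_, ?_, ?_⟩
  · rw [hPP, hQQ, ← cfc_sub _ _ D]
    conv_lhs => rw [← cfc_id' ℝ D]
    congr 1; funext x
    rcases le_total 0 x with h | h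
    · rw [max_eq_left h, max_eq_right (by linarith)]; ring
    · rw [max_eq_right h, max_eq_left (by linarith)]; ring
  · exact Summable.of_nonneg_of_le (fun j => by positivity)
      (fun j => le_add_of_nonneg_right (by positivity)) hsum
  · exact Summable.of_nonneg_of_le (fun j => by positivity)
      (fun j => le_add_of_nonneg_left (by positivity)) hsum

noncomputable def Rr (X : H →L[ℂ] H) (t : ℝ) : H →L[ℂ] H := Ring.inverse (1 + (t : ℂ) • X ^ 2)

noncomputable def Zr (X : H →L[ℂ] H) (t : ℝ) : H →L[ℂ] H := ((√t : ℝ) : ℂ) • (X * Rr X t)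

lemma unit_one_add {X : H →L[ℂ] H} (hX : IsSelfAdjoint X) {t : ℝ} (ht : 0 < t) :
    IsUnit (1 + (t : ℂ) • X ^ 2) := by
  have hI : ∀ s : ℝ, s ≠ 0 → IsUnit (algebraMap ℂ (H →L[ℂ] H) (s * Complex.I) - X) := by
    intro s hs
    by_contra h
    have := hX.mem_spectrum_eq_re (z := s * Complex.I) h
    simp [Complex.ext_iff] at this
    exact hs this
  have hst : 0 < √t := Real.sqrt_pos.mpr ht
  have h := ((hI (1 / √t) (by positivity)).mul (hI (-(1 / √t)) (by simp; positivity)))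
  have h2 : (1 + (t : ℂ) • X ^ 2) = algebraMap ℂ (H →L[ℂ] H) t * ((algebraMap ℂ (H →L[ℂ] H) ((1 / √t : ℝ) * Complex.I) - X) * (algebraMap ℂ (H →L[ℂ] H) ((-(1 / √t) : ℝ) * Complex.I) - X)) := by
    have e : ((√t : ℝ) : ℂ) ^ 2 = t := by norm_cast; exact Real.sq_sqrt ht.le
    have e0 : ((√t : ℝ) : ℂ) ≠ 0 := by exact_mod_cast hst.ne'
    simp only [Algebra.algebraMap_eq_smul_one, sub_mul, mul_sub, smul_mul_assoc, mul_smul_comm,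
      one_mul, mul_one, smul_sub, smul_smul, ← sq]
    push_cast
    match_scalars
    · rw [← e]; field_simp; simp
    · simp
    · field_simp; ring
  rw [h2]
  exact ((isUnit_iff_ne_zero.mpr (by exact_mod_cast ht.ne')).map _).mul h

lemma Rr_sa {X : H →L[ℂ] H} (hX : IsSelfAdjoint X) (t : ℝ) : IsSelfAdjoint (Rr X t) := by
  have : IsSelfAdjoint (1 + (t : ℂ) • X ^ 2) := by
    refine (IsSelfAdjoint.one _).add (IsSelfAdjoint.smul ?_ (hX.pow 2))
    simp [isSelfAdjoint_iff]
  unfold Rr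
  rw [isSelfAdjoint_iff, ← Ring.inverse_star, this.star_eq]

lemma Rr_comm (X : H →L[ℂ] H) {t : ℝ} : Commute X (Rr X t) := by
  unfold Rr
  have hc : Commute X (1 + (t : ℂ) • X ^ 2) :=
    (Commute.one_right _).add_right (((Commute.refl X).pow_right 2).smul_right _)
  by_cases hu : IsUnit (1 + (t : ℂ) • X ^ 2)
  · obtain ⟨u, hu⟩ := hu
    rw [← hu] at hc ⊢
    rw [Ring.inverse_unit]
    exact hc.units_inv_right
  · rw [Ring.inverse_non_unit _ hu]
    exact Commute.zero_right _

lemma Zr_sa {X : H →L[ℂ] H} (hX : IsSelfAdjoint X) (t : ℝ) : IsSelfAdjoint (Zr X t) := by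
  refine IsSelfAdjoint.smul (by simp [isSelfAdjoint_iff]) ?_
  exact (hX.commute_iff (Rr_sa hX t)).mp (Rr_comm X)

lemma RZ_norm {X : H →L[ℂ] H} (hX : IsSelfAdjoint X) {t : ℝ} (ht : 0 < t) (x : H) :
    ‖Rr X t x‖ ≤ ‖x‖ ∧ ‖Zr X t x‖ ≤ ‖x‖ := by
  have h : (1 + (t : ℂ) • X ^ 2) * Rr X t = 1 := Ring.mul_inverse_cancel _ (unit_one_add hX ht)
  have hx : x = Rr X t x + (t : ℂ) • X (X (Rr X t x)) := by
    have := congrArg (fun T : H →L[ℂ] H => T x) h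
    simpa [sq] using this.symm
  have hz : Zr X t x = ((√t : ℝ) : ℂ) • X (Rr X t x) := rfl
  set u := Rr X t x
  have hi : (⟪u, x⟫_ℂ).re = ‖u‖ ^ 2 + t * ‖X u‖ ^ 2 := by
    rw [hx, inner_add_right, inner_smul_right, ← sa_inner hX, inner_self_eq_norm_sq_to_K,
      inner_self_eq_norm_sq_to_K]
    norm_cast
    rw [Complex.add_re, Complex.re_ofReal_mul]
    rfl
  have hle : (⟪u, x⟫_ℂ).re ≤ ‖u‖ * ‖x‖ := re_inner_le_norm (𝕜 := ℂ) u x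
  have hzn : ‖Zr X t x‖ ^ 2 = t * ‖X u‖ ^ 2 := by
    rw [hz, norm_smul, mul_pow]
    simp [Real.sq_sqrt ht.le]
  rw [hi, ← hzn] at hle
  have hu : ‖u‖ ≤ ‖x‖ := by
    by_contra hc
    push Not at hc
    nlinarith [norm_nonneg x, norm_nonneg u, sq_nonneg ‖Zr X t x‖]
  refine ⟨hu, ?_⟩
  refine (sq_le_sq₀ (norm_nonneg _) (norm_nonneg x)).mp ?_
  nlinarith [norm_nonneg x, norm_nonneg u]

lemma tXXR {X : H →L[ℂ] H} (hX : IsSelfAdjoint X) {t : ℝ} (ht : 0 < t) :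
    (t : ℂ) • (X * X * Rr X t) = 1 - Rr X t := by
  have h : (1 + (t : ℂ) • X ^ 2) * Rr X t = 1 := Ring.mul_inverse_cancel _ (unit_one_add hX ht)
  rw [add_mul, one_mul, smul_mul_assoc, sq] at h
  rw [← h, add_sub_cancel_left]

lemma tendsto_closure {X : H →L[ℂ] H} {T : ℝ → H →L[ℂ] H} (hT : ∀ t > 0, ∀ x, ‖T t x‖ ≤ ‖x‖)
    (hr : ∀ y, Tendsto (fun t => T t (X y)) atTop (𝓝 0)) {z : H}
    (hz : z ∈ X.range.topologicalClosure) : Tendsto (fun t => T t z) atTop (𝓝 0) := by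
  rw [Metric.tendsto_nhds]
  intro ε hε
  obtain ⟨w, ⟨y, rfl⟩, hw⟩ := Metric.mem_closure_iff.mp hz (ε / 2) (by positivity)
  filter_upwards [Metric.tendsto_nhds.mp (hr y) (ε / 2) (by positivity), eventually_gt_atTop 0]
    with t h1 ht
  rw [dist_zero_right] at h1 ⊢
  have e : T t z = T t (z - X y) + T t (X y) := by rw [← map_add, sub_add_cancel]
  have h2 := hT t ht (z - X y)
  have h3 : ‖z - X y‖ < ε / 2 := by rw [← dist_eq_norm]; exact hw
  rw [e]
  have := norm_add_le (T t (z - X y)) (T t (X y))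
  linarith

lemma tendsto_inv_sqrt : Tendsto (fun t : ℝ => (√t)⁻¹) atTop (𝓝 0) :=
  tendsto_inv_atTop_zero.comp Real.tendsto_sqrt_atTop

lemma small_tendsto {C : ℝ} {f : ℝ → H} (hf : ∀ t > 0, ‖f t‖ ≤ (√t)⁻¹ * C) :
    Tendsto f atTop (𝓝 0) := by
  refine squeeze_zero_norm' (a := fun t => (√t)⁻¹ * C) ?_ (by simpa using tendsto_inv_sqrt.mul_const C)
  filter_upwards [eventually_gt_atTop 0] with t ht using hf t ht

lemma strong_lim {X : H →L[ℂ] H} (hX : IsSelfAdjoint X) : ∃ E : H →L[ℂ] H, IsSelfAdjoint E ∧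
    X * E = 0 ∧ (∀ x, Tendsto (fun t => Rr X t x) atTop (𝓝 (E x))) ∧
      ∀ x, Tendsto (fun t => Zr X t x) atTop (𝓝 0) := by
  have hcl : IsClosed (X.ker : Set H) := X.isClosed_ker
  have : CompleteSpace X.ker := hcl.completeSpace_coe
  have hXE : ∀ x, X (X.ker.starProjection x) = 0 := fun x =>
    LinearMap.mem_ker.mp (X.ker.starProjection_apply_mem x)
  have hker : ∀ t > 0, ∀ x, X x = 0 → Rr X t x = x := by
    intro t ht x hx
    have h := congrArg (fun T : H →L[ℂ] H => T x) (tXXR hX ht)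
    have hc : ∀ y, X (Rr X t y) = Rr X t (X y) := fun y =>
      congrArg (fun T : H →L[ℂ] H => T y) (Rr_comm X (t := t)).eq
    have h' : (t : ℂ) • X (X (Rr X t x)) = x - Rr X t x := h
    rw [hc, hx, map_zero, map_zero, smul_zero] at h'
    exact (sub_eq_zero.mp h'.symm).symm
  have hperp : ∀ x, x - X.ker.starProjection x ∈ X.range.topologicalClosure := by
    intro x
    have h := X.ker.sub_starProjection_mem_orthogonal x
    rw [X.orthogonal_ker, ← ContinuousLinearMap.star_eq_adjoint, hX.star_eq] at h
    exact h
  have hsq : ∀ t > 0, ∀ y, ((√t : ℝ) : ℂ) • ((√t : ℝ) : ℂ) • y = (t : ℂ) • (y : H) := by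
    intro t ht y
    rw [smul_smul]
    congr 1
    norm_cast
    exact Real.mul_self_sqrt (le_of_lt ht)
  have hRX : ∀ t > 0, ∀ y, ((√t : ℝ) : ℂ) • Rr X t (X y) = Zr X t y := by
    intro t ht y
    have hc : X (Rr X t y) = Rr X t (X y) :=
      congrArg (fun T : H →L[ℂ] H => T y) (Rr_comm X (t := t)).eq
    rw [← hc]; rfl
  have hZX : ∀ t > 0, ∀ y, ((√t : ℝ) : ℂ) • Zr X t (X y) = y - Rr X t y := by
    intro t ht y
    have hc : X (Rr X t y) = Rr X t (X y) :=
      congrArg (fun T : H →L[ℂ] H => T y) (Rr_comm X (t := t)).eq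
    have h : (t : ℂ) • X (X (Rr X t y)) = y - Rr X t y :=
      congrArg (fun T : H →L[ℂ] H => T y) (tXXR hX ht)
    rw [← h, ← hsq t ht, hc]; rfl
  have hbd : ∀ t > 0, ∀ (v : H) (C : ℝ), ‖((√t : ℝ) : ℂ) • v‖ ≤ C → ‖v‖ ≤ (√t)⁻¹ * C := by
    intro t ht v C h
    have hst : 0 < √t := Real.sqrt_pos.mpr ht
    rw [norm_smul, Complex.norm_real, Real.norm_of_nonneg hst.le] at h
    rw [inv_mul_eq_div, le_div_iff₀ hst, mul_comm]
    exact h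
  refine ⟨X.ker.starProjection, isSelfAdjoint_starProjection _, ?_, ?_, ?_⟩
  · ext x; exact hXE x
  · intro x
    have h := tendsto_closure (X := X) (T := Rr X) (fun t ht x => (RZ_norm hX ht x).1)
      (fun y => small_tendsto (C := ‖y‖) fun t ht => hbd t ht _ _ (by
        rw [hRX t ht]; exact (RZ_norm hX ht y).2)) (hperp x)
    have h2 := h.add_const (X.ker.starProjection x)
    rw [zero_add] at h2
    refine h2.congr' ?_
    filter_upwards [eventually_gt_atTop 0] with t ht
    rw [map_sub, hker t ht _ (hXE x), sub_add_cancel]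
  · intro x
    have h := tendsto_closure (X := X) (T := Zr X) (fun t ht x => (RZ_norm hX ht x).2)
      (fun y => small_tendsto (C := ‖y‖ + ‖y‖) fun t ht => hbd t ht _ _ (by
        rw [hZX t ht]
        exact (norm_sub_le _ _).trans (add_le_add_right (RZ_norm hX ht y).1 _))) (hperp x)
    refine h.congr' ?_
    filter_upwards [eventually_gt_atTop 0] with t ht
    have : Zr X t (X.ker.starProjection x) = 0 := by
      change ((√t : ℝ) : ℂ) • X (Rr X t _) = 0
      rw [hker t ht _ (hXE x), hXE, smul_zero]
    rw [map_sub, this, sub_zero]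

lemma main_alg {X Y : H →L[ℂ] H} (hX : IsSelfAdjoint X) (hY : IsSelfAdjoint Y) {t : ℝ}
    (ht : 0 < t) :
    ((1 + t : ℝ) : ℂ) • (X ^ 3 * Ring.inverse (1 + ((t : ℂ)) • X ^ 2))
          - ((1 + t : ℝ) : ℂ) • (Y ^ 3 * Ring.inverse (1 + ((t : ℂ)) • Y ^ 2))
      = (1 + (t : ℂ)⁻¹) • ((X - Y) - (Rr X t * (X - Y) * Rr Y t - Zr X t * (X - Y) * Zr Y t)) := by
  change ((1 + t : ℝ) : ℂ) • (X ^ 3 * Rr X t) - ((1 + t : ℝ) : ℂ) • (Y ^ 3 * Rr Y t) = _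
  have ht0 : (t : ℂ) ≠ 0 := by exact_mod_cast ht.ne'
  have key : ∀ {X : H →L[ℂ] H}, IsSelfAdjoint X → ((1 + t : ℝ) : ℂ) • (X ^ 3 * Rr X t)
      = (1 + (t : ℂ)⁻¹) • (X - X * Rr X t) := by
    intro X hX
    have h : X - X * Rr X t = (t : ℂ) • (X ^ 3 * Rr X t) := by
      calc X - X * Rr X t = X * (1 - Rr X t) := by rw [mul_sub, mul_one]
        _ = _ := by rw [← tXXR hX ht, mul_smul_comm]; simp only [pow_succ, pow_zero, one_mul, mul_assoc]
    rw [h, smul_smul]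
    congr 1
    push_cast
    field_simp
    ring
  have hz : Zr X t * (X - Y) * Zr Y t = (t : ℂ) • (X * Rr X t * (X - Y) * (Y * Rr Y t)) := by
    unfold Zr
    rw [smul_mul_assoc, smul_mul_assoc, mul_smul_comm, smul_smul]
    congr 1
    norm_cast
    exact Real.mul_self_sqrt ht.le
  have hd : X * Rr X t - Y * Rr Y t
      = Rr X t * (X - Y) * Rr Y t - Zr X t * (X - Y) * Zr Y t := by
    have h1 : (t : ℂ) • (X * X * Rr X t) = 1 - Rr X t := tXXR hX ht
    have h2 : (t : ℂ) • (Y * Y * Rr Y t) = 1 - Rr Y t := tXXR hY ht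
    have hc := (Rr_comm X (t := t)).eq
    have e1 : (t : ℂ) • (X * Rr X t * X * (Y * Rr Y t)) = (1 - Rr X t) * (Y * Rr Y t) := by
      rw [← h1, smul_mul_assoc, mul_assoc X (Rr X t) X, ← hc, mul_assoc X X]
    have e2 : (t : ℂ) • (X * Rr X t * Y * (Y * Rr Y t)) = X * Rr X t * (1 - Rr Y t) := by
      rw [← h2, mul_smul_comm]
      simp only [mul_assoc]
    rw [hz, mul_sub (X * Rr X t), sub_mul _ _ (Y * Rr Y t), smul_sub, e1, e2, hc]
    noncomm_ring
  rw [key hX, key hY, ← smul_sub, ← hd]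
  congr 1
  abel

end helpers


/-- For bounded self-adjoint `X, Y` with `X - Y` trace class,
`lim_{t→∞} tr(f_t(X) - f_t(Y)) = tr(X - Y)`. -/
theorem stmt10 {H : Type*} [NormedAddCommGroup H] [InnerProductSpace ℂ H] [CompleteSpace H]
    {ι : Type*} (b : HilbertBasis ι ℂ H) (X Y : H →L[ℂ] H)
    (hX : IsSelfAdjoint X) (hY : IsSelfAdjoint Y) (h1 : MemSchatten b 1 (X - Y)) :
    Filter.Tendsto
      (fun t : ℝ =>
        traceB b (((1 + t : ℝ) : ℂ) • (X ^ 3 * Ring.inverse (1 + ((t : ℂ)) • X ^ 2))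
          - ((1 + t : ℝ) : ℂ) • (Y ^ 3 * Ring.inverse (1 + ((t : ℂ)) • Y ^ 2))))
      Filter.atTop (nhds (traceB b (X - Y))) := by
  have hD : IsSelfAdjoint (X - Y) := hX.sub hY
  obtain ⟨P, Q, hP, hQ, hPQ, sP, sQ⟩ := decomp b hD h1
  obtain ⟨E, hE, hXE, hRE, hZE⟩ := strong_lim hX
  obtain ⟨F, hF, hYF, hRF, hZF⟩ := strong_lim hY
  let τ : (H →L[ℂ] H) → (H →L[ℂ] H) → ℂ := fun A B =>
    (∑' j, ⟪B (P (b j)), A (P (b j))⟫_ℂ) - ∑' j, ⟪B (Q (b j)), A (Q (b j))⟫_ℂ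
  have hτ : ∀ A B : H →L[ℂ] H, IsSelfAdjoint A → IsSelfAdjoint B →
      HasSum (fun i => ⟪b i, (A * (X - Y) * B) (b i)⟫_ℂ) (τ A B) := by
    intro A B hA hB
    have h := (trace_cyc b hP hA hB sP).sub (trace_cyc b hQ hA hB sQ)
    have e : (fun i => ⟪b i, (A * (P * P) * B) (b i)⟫_ℂ - ⟪b i, (A * (Q * Q) * B) (b i)⟫_ℂ)
        = fun i => ⟪b i, (A * (X - Y) * B) (b i)⟫_ℂ := by
      funext i
      rw [hPQ, ← inner_sub_right, mul_sub, sub_mul]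
      rfl
    rw [e] at h
    exact h
  have hD0 : HasSum (fun i => ⟪b i, (X - Y) (b i)⟫_ℂ) (τ 1 1) := by
    simpa using hτ 1 1 (IsSelfAdjoint.one _) (IsSelfAdjoint.one _)
  have hT0 : traceB b (X - Y) = τ 1 1 := hD0.tsum_eq
  have hEX : E * X = 0 := by
    have h := congrArg star hXE
    rwa [star_mul, hE.star_eq, hX.star_eq, star_zero] at h
  have hlim0 : τ E F = 0 := by
    refine (hτ E F hE hF).unique ?_
    have : E * (X - Y) * F = 0 := by
      rw [mul_sub, hEX, zero_sub, neg_mul, mul_assoc, hYF, mul_zero, neg_zero]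
    rw [this]
    simp [hasSum_zero]
  have hR : Filter.Tendsto (fun t => τ (Rr X t) (Rr Y t)) Filter.atTop (nhds 0) := by
    rw [← hlim0]
    exact (trace_lim b sP (fun t ht x => (RZ_norm hX ht x).1) (fun t ht x => (RZ_norm hY ht x).1)
      hRE hRF).sub (trace_lim b sQ (fun t ht x => (RZ_norm hX ht x).1)
      (fun t ht x => (RZ_norm hY ht x).1) hRE hRF)
  have hZ : Filter.Tendsto (fun t => τ (Zr X t) (Zr Y t)) Filter.atTop (nhds 0) := by
    have e : τ 0 0 = 0 := by simp [τ]
    rw [← e]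
    exact (trace_lim b sP (fun t ht x => (RZ_norm hX ht x).2) (fun t ht x => (RZ_norm hY ht x).2)
      hZE hZF).sub (trace_lim b sQ (fun t ht x => (RZ_norm hX ht x).2)
      (fun t ht x => (RZ_norm hY ht x).2) hZE hZF)
  have hinv : Filter.Tendsto (fun t : ℝ => 1 + (t : ℂ)⁻¹) Filter.atTop (nhds 1) := by
    have h := (Complex.continuous_ofReal.tendsto 0).comp tendsto_inv_atTop_zero
    have h2 := h.const_add 1
    simpa [Function.comp_def] using h2
  have hfin : Filter.Tendsto (fun t : ℝ => (1 + (t : ℂ)⁻¹) *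
      (τ 1 1 - (τ (Rr X t) (Rr Y t) - τ (Zr X t) (Zr Y t)))) Filter.atTop (nhds (τ 1 1)) := by
    simpa using hinv.mul ((hR.sub hZ).const_sub (τ 1 1))
  rw [hT0]
  refine hfin.congr' ?_
  filter_upwards [Filter.eventually_gt_atTop 0] with t ht
  rw [main_alg hX hY ht]
  have h := ((hD0.sub ((hτ _ _ (Rr_sa hX t) (Rr_sa hY t)).sub
    (hτ _ _ (Zr_sa hX t) (Zr_sa hY t)))).mul_left (1 + (t : ℂ)⁻¹))
  rw [← h.tsum_eq]
  unfold traceB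
  refine tsum_congr fun i => ?_
  rw [← inner_sub_right, ← inner_sub_right, ← inner_smul_right]
  rfl
end

section
/- Let H be a bounded self-adjoint operator on ℓ^2(ℤ×ℕ) whose kernel satisfies |H(r₁,r₂)| ≤ C_N(1+|r₁-r₂|)^{-N} for every N (rapid off-diagonal decay), and let χ: ℤ → ℝ be a switch function (χ(x) = 1 for x large negative, χ(x) = 0 for x large positive, with χ' of compact support, i.e. χ constant outside a finite interval). Let G be a bounded operator whose kernel satisfies |G(r₁,r₂)| ≤ C_N(1+|r₁-r₂|)^{-N} e^{-κ(y₁+y₂)} for some κ > 0. Then the commutator product [H, χ(x)]·G is trace class. -/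
open scoped InnerProductSpace
open ContinuousLinearMap in
lemma aux_abs_s17 {E ι : Type*} [NormedAddCommGroup E] [InnerProductSpace ℂ E] [CompleteSpace E]
    (A D : E →L[ℂ] E) (hD : 0 ≤ D) (hAD : ∀ ψ, ‖A ψ‖ ≤ ‖D ψ‖) (b : HilbertBasis ι ℂ E)
    (hb : Summable fun i => (⟪b i, D (b i)⟫_ℂ).re) : MemSchatten b 1 A := by
  have hsD : IsSelfAdjoint D := IsSelfAdjoint.of_nonneg hD
  have hle : adjoint A * A ≤ D * D := by
    rw [ContinuousLinearMap.le_def, isPositive_def']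
    refine ⟨IsSelfAdjoint.sub ?_ (IsSelfAdjoint.star_mul_self A), fun ψ => ?_⟩
    · have := IsSelfAdjoint.star_mul_self D
      rwa [hsD.star_eq] at this
    have e1 : ⟪(D * D) ψ, ψ⟫_ℂ = (‖D ψ‖ ^ 2 : ℝ) := by
      have : ⟪D (D ψ), ψ⟫_ℂ = ⟪D ψ, D ψ⟫_ℂ := ((nonneg_iff_isPositive D).1 hD).isSymmetric _ _
      change ⟪D (D ψ), ψ⟫_ℂ = _
      rw [this, inner_self_eq_norm_sq_to_K]; simp
    have e2 : ⟪(adjoint A * A) ψ, ψ⟫_ℂ = (‖A ψ‖ ^ 2 : ℝ) := by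
      change ⟪adjoint A (A ψ), ψ⟫_ℂ = _
      rw [adjoint_inner_left, inner_self_eq_norm_sq_to_K]; simp
    rw [reApplyInnerSelf_apply, sub_apply, inner_sub_left, e1, e2, ← Complex.ofReal_sub]
    have := pow_le_pow_left₀ (norm_nonneg _) (hAD ψ) 2
    simp only [RCLike.re_to_complex, Complex.ofReal_re]
    linarith
  have hAA : 0 ≤ adjoint A * A := star_mul_self_nonneg A
  have hsqrt : cfc (fun x : ℝ => x ^ ((1:ℝ) / 2)) (adjoint A * A) ≤ D := by
    have h := CFC.sqrt_le_sqrt _ _ hle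
    rw [CFC.sqrt_mul_self _ hD, CFC.sqrt_eq_real_sqrt _ hAA, cfcₙ_eq_cfc] at h
    simpa only [← Real.sqrt_eq_rpow] using h
  have hnn : 0 ≤ cfc (fun x : ℝ => x ^ ((1:ℝ) / 2)) (adjoint A * A) := by
    refine cfc_nonneg (fun x hx => ?_)
    exact Real.rpow_nonneg (spectrum_nonneg_of_nonneg hAA hx) _
  unfold MemSchatten
  refine Summable.of_nonneg_of_le (fun i => ?_) (fun i => ?_) hb
  · exact ((nonneg_iff_isPositive _).1 hnn).re_inner_nonneg_right (b i)
  · have := ((ContinuousLinearMap.le_def _ _).1 hsqrt).re_inner_nonneg_right (b i)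
    simp only [sub_apply, inner_sub_right] at this
    simpa using this

open InnerProductSpace in
lemma aux_W (w : ℤ × ℕ → ℝ) (hw0 : ∀ s, 0 ≤ w s) (hw : Summable w) :
    ∃ W : lp (fun _ : ℤ × ℕ => ℂ) 2 →L[ℂ] lp (fun _ : ℤ × ℕ => ℂ) 2,
      ∀ ψ q, W ψ q = (w q : ℂ) * ψ q := by
  have hs : Summable (fun s => (w s : ℂ) •
      rankOne ℂ (lp.single 2 s (1:ℂ) : lp (fun _ : ℤ × ℕ => ℂ) 2)
        (lp.single 2 s (1:ℂ) : lp (fun _ : ℤ × ℕ => ℂ) 2)) := by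
    refine Summable.of_norm_bounded hw (fun s => ?_)
    rw [norm_smul]
    simp [lp.norm_single, abs_of_nonneg (hw0 s)]
  refine ⟨∑' s, (w s : ℂ) •
      rankOne ℂ (lp.single 2 s (1:ℂ) : lp (fun _ : ℤ × ℕ => ℂ) 2)
        (lp.single 2 s (1:ℂ) : lp (fun _ : ℤ × ℕ => ℂ) 2), fun ψ q => ?_⟩
  have h1 := (hs.hasSum.mapL (ContinuousLinearMap.apply ℂ _ ψ)).mapL
    (innerSL ℂ (lp.single 2 q (1:ℂ) : lp (fun _ : ℤ × ℕ => ℂ) 2))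
  have h2 : HasSum (fun s => if s = q then (w q : ℂ) * ψ q else 0) ((w q : ℂ) * ψ q) :=
    hasSum_ite_eq q _
  have h3 := h1.unique (h2.congr_fun (fun s => ?_))
  · simpa [lp.inner_single_left] using h3
  · by_cases h : s = q
    · subst h
      simp [lp.inner_single_left]
    · simp [lp.inner_single_left, h, Ne.symm h]

/-- A vector is the sum of its coordinates times the standard basis. -/
lemma aux_norm_le (B : lp (fun _ : ℤ × ℕ => ℂ) 2 →L[ℂ] lp (fun _ : ℤ × ℕ => ℂ) 2)
    (ψ : lp (fun _ : ℤ × ℕ => ℂ) 2) (f : ℤ × ℕ → ℝ) (hf : Summable f)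
    (h : ∀ s, ‖ψ s‖ * ‖B (lp.single 2 s (1:ℂ))‖ ≤ f s) : ‖B ψ‖ ≤ ∑' s, f s := by
  have h1 : HasSum (fun s => lp.single 2 s (ψ s)) ψ :=
    lp.hasSum_single (by simp) ψ
  have h2 := h1.mapL B
  rw [← h2.tsum_eq]
  refine tsum_of_norm_bounded hf.hasSum (fun s => ?_)
  have : (lp.single 2 s (ψ s) : lp (fun _ : ℤ × ℕ => ℂ) 2) = ψ s • lp.single 2 s (1:ℂ) := by
    rw [← lp.single_smul]; simp
  rw [this, map_smul, norm_smul]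
  exact h s

open ContinuousLinearMap in
lemma aux_main (A : lp (fun _ : ℤ × ℕ => ℂ) 2 →L[ℂ] lp (fun _ : ℤ × ℕ => ℂ) 2)
    (w : ℤ × ℕ → ℝ) (hw0 : ∀ s, 0 ≤ w s) (hw : Summable w) (C : ℝ) (hC : 0 ≤ C)
    (hA : ∀ s, ‖A (lp.single 2 s (1:ℂ))‖ ≤ C * w s ^ 2)
    (b : HilbertBasis (ℤ × ℕ) ℂ (lp (fun _ : ℤ × ℕ => ℂ) 2)) :
    MemSchatten b 1 A := by
  obtain ⟨W, hW⟩ := aux_W w hw0 hw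
  set c : ℝ := C * ∑' s, w s with hc
  have hc0 : 0 ≤ c := mul_nonneg hC (tsum_nonneg hw0)
  have hinner : ∀ ψ, HasSum (fun s => w s * ‖ψ s‖ ^ 2) (⟪ψ, W ψ⟫_ℂ).re := by
    intro ψ
    have := (lp.hasSum_inner ψ (W ψ)).mapL Complex.reCLM
    refine this.congr_fun (fun s => ?_)
    have : ⟪ψ s, W ψ s⟫_ℂ = ((w s * ‖ψ s‖ ^ 2 : ℝ) : ℂ) := by
      rw [hW]
      simp only [RCLike.inner_apply, mul_assoc]
      rw [Complex.mul_conj']; push_cast; ring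
    rw [this, Complex.reCLM_apply, Complex.ofReal_re]
  have hWpos : W.IsPositive := by
    refine ⟨?_, ?_⟩
    · intro ψ φ
      simp only [coe_coe]
      rw [lp.inner_eq_tsum, lp.inner_eq_tsum]
      congr 1; ext s
      rw [hW, hW]; simp; ring
    · intro ψ
      rw [reApplyInnerSelf_apply, inner_re_symm]
      exact (hinner ψ).nonneg (fun s => mul_nonneg (hw0 s) (by positivity))
  have hWsa : adjoint W = W := hWpos.isSelfAdjoint
  have hcW : (0 : lp (fun _ : ℤ × ℕ => ℂ) 2 →L[ℂ] lp (fun _ : ℤ × ℕ => ℂ) 2) ≤ (c:ℂ) • W := by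
    rw [nonneg_iff_isPositive]
    exact hWpos.smul_of_nonneg (by exact_mod_cast hc0)
  have hnorm : ∀ ψ, ‖A ψ‖ ≤ c * ‖W ψ‖ := by
    intro ψ
    have := aux_norm_le A ψ (fun s => C * ‖W ψ‖ * w s) (hw.mul_left _) (fun s => ?_)
    · rw [tsum_mul_left] at this
      rw [hc]; linarith
    · calc ‖ψ s‖ * ‖A (lp.single 2 s (1:ℂ))‖ ≤ ‖ψ s‖ * (C * w s ^ 2) := by
            gcongr; exact hA s
        _ = C * ‖W ψ s‖ * w s := by
            rw [hW, norm_mul, Complex.norm_real, Real.norm_of_nonneg (hw0 s)]; ring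
        _ ≤ _ := by
            have := lp.norm_apply_le_norm (by simp) (W ψ) s
            have := hw0 s
            gcongr
  -- summability of the diagonal of `W`
  have hpar : ∀ s, HasSum (fun i => w s * ‖b i s‖ ^ 2) (w s) := by
    intro s
    have h := (b.hasSum_inner_mul_inner (lp.single 2 s (1:ℂ)) (lp.single 2 s (1:ℂ))).mapL
      Complex.reCLM
    have h' : HasSum (fun i => ‖b i s‖ ^ 2) 1 := by
      convert h using 1
      · ext i
        rw [lp.inner_single_left, lp.inner_single_right]
        simp [Complex.mul_conj', ← Complex.ofReal_pow]
      · rw [lp.inner_single_left]; simp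
    simpa using h'.mul_left (w s)
  have hsum2 : Summable (fun p : (ℤ × ℕ) × (ℤ × ℕ) => w p.1 * ‖b p.2 p.1‖ ^ 2) := by
    rw [summable_prod_of_nonneg (fun p => mul_nonneg (hw0 _) (by positivity))]
    refine ⟨fun s => (hpar s).summable, ?_⟩
    simpa only [(hpar _).tsum_eq] using hw
  have hdiag : Summable (fun i => (⟪b i, W (b i)⟫_ℂ).re) := by
    have := ((summable_prod_of_nonneg (fun p => mul_nonneg (hw0 _) (by positivity))).1
      hsum2.prod_symm).2
    refine this.congr (fun i => ?_)
    exact (hinner (b i)).tsum_eq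
  refine aux_abs_s17 A _ hcW (fun ψ => ?_) b ?_
  · have : ((c:ℂ) • W) ψ = (c:ℂ) • W ψ := rfl
    rw [this, norm_smul, Complex.norm_real, Real.norm_of_nonneg hc0]
    exact hnorm ψ
  · refine (hdiag.mul_left c).congr (fun i => ?_)
    have : ((c:ℂ) • W) (b i) = (c:ℂ) • W (b i) := rfl
    rw [this, inner_smul_right, Complex.re_ofReal_mul]

/-- The summable weight `(1+|n|)^{-2}` on `ℤ`. -/
noncomputable def auxRho (n : ℤ) : ℝ := ((1 + |(n : ℝ)|) ^ 2)⁻¹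

lemma auxRho_pos (n : ℤ) : 0 < auxRho n := by unfold auxRho; positivity

lemma auxRho_summable : Summable auxRho := by
  have h : Summable fun n : ℕ => (((n:ℝ) + 1) ^ 2)⁻¹ := by
    have := (summable_nat_add_iff 1).2 (Real.summable_nat_pow_inv (p := 2).2 (by norm_num))
    simpa using this
  refine Summable.of_nat_of_neg ?_ ?_ <;>
  · refine h.congr (fun n => ?_)
    simp [auxRho, add_comm]

lemma auxRho2_summable : Summable (fun p : ℤ × ℤ => auxRho p.1 * auxRho p.2) :=
  auxRho_summable.mul_of_nonneg auxRho_summable (fun n => (auxRho_pos n).le)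
    (fun n => (auxRho_pos n).le)

lemma aux_shift (s : ℤ × ℕ) :
    Summable (fun r : ℤ × ℕ => auxRho (r.1 - s.1) * auxRho ((r.2 : ℤ) - s.2)) ∧
    ∑' r : ℤ × ℕ, auxRho (r.1 - s.1) * auxRho ((r.2 : ℤ) - s.2) ≤
      ∑' p : ℤ × ℤ, auxRho p.1 * auxRho p.2 := by
  have hinj : Function.Injective (fun r : ℤ × ℕ => ((r.1 - s.1, (r.2:ℤ) - s.2) : ℤ × ℤ)) := by
    rintro ⟨a, c⟩ ⟨a', c'⟩ h
    simp at h
    ext <;> simp <;> omega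
  have h1 := auxRho2_summable.comp_injective hinj
  refine ⟨h1, ?_⟩
  exact h1.tsum_le_tsum_of_inj _ hinj
    (fun c _ => mul_nonneg (auxRho_pos _).le (auxRho_pos _).le) (fun r => le_rfl) auxRho2_summable

/-- Conversion of the decay bound with `N = 8`. -/
lemma aux_decay (a c : ℤ) :
    (1 + Real.sqrt ((a:ℝ) ^ 2 + (c:ℝ) ^ 2)) ^ (-((8:ℕ):ℝ)) ≤
      auxRho a * auxRho c * auxRho a ^ 2 := by
  rw [Real.rpow_neg (by positivity), Real.rpow_natCast]
  have h1 : |(a:ℝ)| ≤ Real.sqrt ((a:ℝ) ^ 2 + (c:ℝ) ^ 2) :=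
    Real.abs_le_sqrt (by nlinarith [sq_nonneg (c:ℝ)])
  have h2 : |(c:ℝ)| ≤ Real.sqrt ((a:ℝ) ^ 2 + (c:ℝ) ^ 2) :=
    Real.abs_le_sqrt (by nlinarith [sq_nonneg (a:ℝ)])
  set D := Real.sqrt ((a:ℝ) ^ 2 + (c:ℝ) ^ 2)
  unfold auxRho
  rw [inv_pow ((1 + |(a:ℝ)|) ^ 2), ← mul_inv, ← mul_inv]
  refine inv_anti₀ (by positivity) ?_
  have : (1 + D) ^ 8 = (1 + D) ^ 2 * (1 + D) ^ 2 * ((1 + D) ^ 2) ^ 2 := by ring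
  rw [this]
  gcongr

/-- The Peetre inequality. -/
lemma aux_peetre (x z : ℤ) : auxRho x * auxRho (x - z) ≤ auxRho z := by
  unfold auxRho
  rw [← mul_inv, ← mul_pow]
  refine inv_anti₀ (by positivity) ?_
  have h : |(z:ℝ)| ≤ |(x:ℝ)| + |((x - z : ℤ):ℝ)| := by
    have := abs_sub (x:ℝ) ((x:ℝ) - z)
    push_cast
    simpa using this
  gcongr
  nlinarith [abs_nonneg (x:ℝ), abs_nonneg ((x - z : ℤ):ℝ)]

lemma aux_exp (κ : ℝ) (hκ : 0 < κ) : ∃ C : ℝ, 0 ≤ C ∧ ∀ y : ℕ,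
    Real.exp (-κ * y) ≤ C * auxRho y ^ 2 := by
  refine ⟨24 / κ ^ 4 * Real.exp κ, by positivity, fun y => ?_⟩
  have h := Real.pow_div_factorial_le_exp (x := κ * (1 + y)) (by positivity) 4
  have e : Real.exp (κ * (1 + y)) = Real.exp κ * (Real.exp (-κ * y))⁻¹ := by
    rw [← Real.exp_neg, ← Real.exp_add]; ring_nf
  rw [e] at h
  have hf : ((Nat.factorial 4 : ℕ) : ℝ) = 24 := by norm_num [Nat.factorial]
  rw [hf] at h
  have hp := Real.exp_pos (-κ * y)
  set t := Real.exp (-κ * y)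
  unfold auxRho
  have hy : |((y:ℤ):ℝ)| = y := by simp
  rw [hy]
  have h3 : (κ * (1 + y)) ^ 4 / 24 * t ≤ Real.exp κ := by
    calc _ ≤ Real.exp κ * t⁻¹ * t := by gcongr
      _ = _ := by field_simp
  rw [show 24 / κ ^ 4 * Real.exp κ * (((1 + (y:ℝ)) ^ 2)⁻¹) ^ 2
    = Real.exp κ / ((κ * (1 + y)) ^ 4 / 24) by field_simp]
  rw [le_div_iff₀ (by positivity)]
  linarith

/-- Lower bound on the distance across the switch. -/
lemma aux_switch (χ : ℤ → ℝ) (hχleft : ∃ m : ℤ, ∀ x ≤ m, χ x = 1)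
    (hχright : ∃ M : ℤ, ∀ x, M ≤ x → χ x = 0) (B : ℝ) (hB : ∀ x, |χ x| ≤ B) :
    ∃ C : ℝ, 0 ≤ C ∧ ∀ x z : ℤ, |χ x - χ z| * auxRho (z - x) ^ 2 ≤ C * auxRho x ^ 2 := by
  obtain ⟨m, hm⟩ := hχleft
  obtain ⟨M, hM⟩ := hχright
  have hB0 : 0 ≤ B := (abs_nonneg _).trans (hB 0)
  set L : ℤ := |m| + |M| with hL
  have hL0 : 0 ≤ L := by positivity
  have hL0' : (0:ℝ) ≤ L := by exact_mod_cast hL0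
  refine ⟨2 * B * (1 + L) ^ 4, by positivity, fun x z => ?_⟩
  by_cases h : χ x = χ z
  · have := auxRho_pos x
    rw [h]; simp; positivity
  have key : |x| ≤ L + |z - x| := by
    by_contra hcon
    push Not at hcon
    have a1 := neg_abs_le m
    have a2 := le_abs_self m
    have a3 := neg_abs_le M
    have a4 := le_abs_self M
    have a5 := neg_abs_le (z - x)
    have a6 := le_abs_self (z - x)
    rcases abs_cases x with ⟨hx, hx'⟩ | ⟨hx, hx'⟩
    · exact h (by rw [hM x (by omega), hM z (by omega)])
    · exact h (by rw [hm x (by omega), hm z (by omega)])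
  have key' : |(x:ℝ)| ≤ L + |((z - x : ℤ):ℝ)| := by exact_mod_cast key
  have h1 : |χ x - χ z| ≤ 2 * B := by
    have := abs_sub (χ x) (χ z)
    have := hB x
    have := hB z
    linarith
  have h2 : auxRho (z - x) ^ 2 ≤ (1 + L) ^ 4 * auxRho x ^ 2 := by
    unfold auxRho
    rw [← inv_pow, ← inv_pow, ← pow_mul, ← pow_mul, inv_pow, inv_pow,
      ← div_eq_mul_inv, le_div_iff₀ (by positivity), inv_mul_le_iff₀ (by positivity), ← mul_pow]
    refine pow_le_pow_left₀ (by positivity) ?_ 4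
    nlinarith [abs_nonneg ((z - x : ℤ):ℝ)]
  calc _ ≤ 2 * B * ((1 + L) ^ 4 * auxRho x ^ 2) := by gcongr
    _ = _ := by ring

/-- Let `H` be a bounded self-adjoint operator on `ℓ²(ℤ×ℕ)` with rapid off-diagonal
kernel decay, `χ` a switch function on `ℤ` (constant `1` far left, `0` far right),
`Mχ` the multiplication operator by `χ(x)`, and `G` a bounded operator whose kernel
decays rapidly off the diagonal and exponentially in `y₁ + y₂`.
Then `[H, χ(x)]·G` is trace class. -/
theorem stmt17
    (T : lp (fun _ : ℤ × ℕ => ℂ) 2 →L[ℂ] lp (fun _ : ℤ × ℕ => ℂ) 2)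
    (hT : IsSelfAdjoint T)
    (Tker : ℤ × ℕ → ℤ × ℕ → ℂ)
    (hTker : ∀ r₁ r₂, Tker r₁ r₂ = ⟪lp.single 2 r₁ (1 : ℂ), T (lp.single 2 r₂ (1 : ℂ))⟫_ℂ)
    (hTdec : ∀ N : ℕ, ∃ C : ℝ, ∀ r₁ r₂ : ℤ × ℕ, ‖Tker r₁ r₂‖ ≤
      C * (1 + Real.sqrt ((((r₁.1 - r₂.1 : ℤ) : ℝ)) ^ 2
        + (((r₁.2 : ℤ) - (r₂.2 : ℤ) : ℤ) : ℝ) ^ 2)) ^ (-(N : ℝ)))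
    (χ : ℤ → ℝ)
    (hχleft : ∃ m : ℤ, ∀ x ≤ m, χ x = 1) (hχright : ∃ M : ℤ, ∀ x, M ≤ x → χ x = 0)
    (Mχ : lp (fun _ : ℤ × ℕ => ℂ) 2 →L[ℂ] lp (fun _ : ℤ × ℕ => ℂ) 2)
    (hMχ : ∀ (ψ : lp (fun _ : ℤ × ℕ => ℂ) 2) (r : ℤ × ℕ), Mχ ψ r = (χ r.1 : ℂ) * ψ r)
    (G : lp (fun _ : ℤ × ℕ => ℂ) 2 →L[ℂ] lp (fun _ : ℤ × ℕ => ℂ) 2)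
    (Gker : ℤ × ℕ → ℤ × ℕ → ℂ)
    (hGker : ∀ r₁ r₂, Gker r₁ r₂ = ⟪lp.single 2 r₁ (1 : ℂ), G (lp.single 2 r₂ (1 : ℂ))⟫_ℂ)
    (κ : ℝ) (hκ : 0 < κ)
    (hGdec : ∀ N : ℕ, ∃ C : ℝ, ∀ r₁ r₂ : ℤ × ℕ, ‖Gker r₁ r₂‖ ≤
      C * (1 + Real.sqrt ((((r₁.1 - r₂.1 : ℤ) : ℝ)) ^ 2
        + (((r₁.2 : ℤ) - (r₂.2 : ℤ) : ℤ) : ℝ) ^ 2)) ^ (-(N : ℝ))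
        * Real.exp (-κ * ((r₁.2 : ℝ) + (r₂.2 : ℝ))))
    (b : HilbertBasis (ℤ × ℕ) ℂ (lp (fun _ : ℤ × ℕ => ℂ) 2)) :
    MemSchatten b 1 ((T * Mχ - Mχ * T) * G) := by
  have hδ : ∀ r : ℤ × ℕ, ‖(lp.single 2 r (1:ℂ) : lp (fun _ : ℤ × ℕ => ℂ) 2)‖ = 1 := by
    intro r; rw [lp.norm_single (by norm_num)]; simp
  have hTapp : ∀ q r : ℤ × ℕ, T (lp.single 2 r (1:ℂ)) q = Tker q r := by
    intro q r; rw [hTker, lp.inner_single_left]; simp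
  have hGapp : ∀ q r : ℤ × ℕ, G (lp.single 2 r (1:ℂ)) q = Gker q r := by
    intro q r; rw [hGker, lp.inner_single_left]; simp
  have hB : ∀ x, |χ x| ≤ ‖Mχ‖ := by
    intro x
    have h1 := lp.norm_apply_le_norm (by simp) (Mχ (lp.single 2 ((x, 0) : ℤ × ℕ) (1:ℂ))) (x, 0)
    have h2 := Mχ.le_opNorm (lp.single 2 ((x, 0) : ℤ × ℕ) (1:ℂ))
    rw [hδ, mul_one] at h2
    rw [hMχ, lp.single_apply_self] at h1
    simp only [mul_one, Complex.norm_real, Real.norm_eq_abs] at h1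
    exact h1.trans h2
  obtain ⟨Cχ, hCχ0, hCχ⟩ := aux_switch χ hχleft hχright _ hB
  obtain ⟨CT, hCT⟩ := hTdec 8
  obtain ⟨CG, hCG⟩ := hGdec 8
  obtain ⟨Ce, hCe0, hCe⟩ := aux_exp κ hκ
  set S : ℝ := ∑' p : ℤ × ℤ, auxRho p.1 * auxRho p.2 with hS
  have hS0 : 0 ≤ S := tsum_nonneg (fun p => mul_nonneg (auxRho_pos _).le (auxRho_pos _).le)
  set K := T * Mχ - Mχ * T with hK
  have hMδ : ∀ r : ℤ × ℕ, Mχ (lp.single 2 r (1:ℂ)) = (χ r.1 : ℂ) • lp.single 2 r (1:ℂ) := by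
    intro r
    ext q
    rw [hMχ, lp.coeFn_smul, Pi.smul_apply]
    by_cases h : q = r
    · subst h; simp
    · simp [lp.single_apply, h]
  have hKapp : ∀ q r : ℤ × ℕ, K (lp.single 2 r (1:ℂ)) q = ((χ r.1 - χ q.1 : ℝ) : ℂ) * Tker q r := by
    intro q r
    have : K (lp.single 2 r (1:ℂ)) = T (Mχ (lp.single 2 r (1:ℂ))) - Mχ (T (lp.single 2 r (1:ℂ))) :=
      rfl
    rw [this, hMδ, map_smul, lp.coeFn_sub, Pi.sub_apply, hMχ, lp.coeFn_smul, Pi.smul_apply, hTapp]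
    push_cast; simp only [smul_eq_mul]; ring
  -- column norms of the commutator
  have hKnorm : ∀ r : ℤ × ℕ, ‖K (lp.single 2 r (1:ℂ))‖ ≤ |CT| * Cχ * S * auxRho r.1 ^ 2 := by
    intro r
    obtain ⟨hs, hle⟩ := aux_shift r
    have := aux_norm_le 1 (K (lp.single 2 r (1:ℂ))) _
      (hs.mul_left (|CT| * Cχ * auxRho r.1 ^ 2)) (fun q => ?_)
    · rw [tsum_mul_left] at this
      refine this.trans ?_
      calc _ ≤ |CT| * Cχ * auxRho r.1 ^ 2 * S := by gcongr
        _ = _ := by ring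
    · have e1 : ‖(1 : lp (fun _ : ℤ × ℕ => ℂ) 2 →L[ℂ] lp (fun _ : ℤ × ℕ => ℂ) 2)
          (lp.single 2 q (1:ℂ))‖ = 1 := hδ q
      rw [e1, mul_one, hKapp, norm_mul, Complex.norm_real, Real.norm_eq_abs]
      have p1 := auxRho_pos (q.1 - r.1)
      have p2 := auxRho_pos ((q.2:ℤ) - r.2)
      have h1 : ‖Tker q r‖ ≤ |CT| * (auxRho (q.1 - r.1) * auxRho ((q.2:ℤ) - r.2)
          * auxRho (q.1 - r.1) ^ 2) :=
        (hCT q r).trans (mul_le_mul (le_abs_self _) (aux_decay _ _) (by positivity) (abs_nonneg _))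
      calc _ ≤ |χ r.1 - χ q.1| * (|CT| * (auxRho (q.1 - r.1) * auxRho ((q.2:ℤ) - r.2)
          * auxRho (q.1 - r.1) ^ 2)) := by gcongr
        _ = |CT| * (|χ r.1 - χ q.1| * auxRho (q.1 - r.1) ^ 2) *
            (auxRho (q.1 - r.1) * auxRho ((q.2:ℤ) - r.2)) := by ring
        _ ≤ |CT| * (Cχ * auxRho r.1 ^ 2) *
            (auxRho (q.1 - r.1) * auxRho ((q.2:ℤ) - r.2)) := by
          have := hCχ r.1 q.1
          exact mul_le_mul_of_nonneg_right (mul_le_mul_of_nonneg_left this (abs_nonneg _))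
            (by positivity)
        _ = _ := by ring
  -- weights
  have hw : Summable (fun s : ℤ × ℕ => auxRho s.1 * auxRho (s.2 : ℤ)) := by
    simpa using (aux_shift (0, 0)).1
  refine aux_main (K * G) (fun s => auxRho s.1 * auxRho (s.2 : ℤ))
    (fun s => mul_nonneg (auxRho_pos _).le (auxRho_pos _).le) hw
    (|CG| * Ce * (|CT| * Cχ * S) * S) (by positivity) (fun s => ?_) b
  obtain ⟨hs, hle⟩ := aux_shift s
  have q1 := auxRho_pos s.1
  have q2 := auxRho_pos (s.2 : ℤ)
  have := aux_norm_le K (G (lp.single 2 s (1:ℂ))) _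
    (hs.mul_left (|CG| * Ce * (|CT| * Cχ * S) * (auxRho s.1 * auxRho (s.2 : ℤ)) ^ 2)) (fun r => ?_)
  · rw [tsum_mul_left] at this
    refine LE.le.trans this ?_
    calc _ ≤ |CG| * Ce * (|CT| * Cχ * S) * (auxRho s.1 * auxRho (s.2 : ℤ)) ^ 2 * S := by gcongr
      _ = _ := by ring
  · rw [hGapp]
    have p0 := auxRho_pos r.1
    have p1 := auxRho_pos (r.1 - s.1)
    have p2 := auxRho_pos ((r.2:ℤ) - s.2)
    have he : Real.exp (-κ * ((r.2 : ℝ) + (s.2 : ℝ))) ≤ Ce * auxRho s.2 ^ 2 := by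
      refine le_trans (Real.exp_le_exp.2 ?_) (hCe s.2)
      have : 0 ≤ κ * (r.2:ℝ) := by positivity
      linarith
    have h1 : ‖Gker r s‖ ≤ |CG| * (auxRho (r.1 - s.1) * auxRho ((r.2:ℤ) - s.2)
        * auxRho (r.1 - s.1) ^ 2) * (Ce * auxRho s.2 ^ 2) :=
      (hCG r s).trans (mul_le_mul (mul_le_mul (le_abs_self _) (aux_decay _ _) (by positivity)
        (abs_nonneg _)) he (by positivity) (by positivity))
    have h2 := hKnorm r
    have h3 := pow_le_pow_left₀ (by positivity) (aux_peetre r.1 s.1) 2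
    calc _ ≤ |CG| * (auxRho (r.1 - s.1) * auxRho ((r.2:ℤ) - s.2)
        * auxRho (r.1 - s.1) ^ 2) * (Ce * auxRho s.2 ^ 2) * (|CT| * Cχ * S * auxRho r.1 ^ 2) := by
          gcongr
      _ = |CG| * Ce * (|CT| * Cχ * S) * ((auxRho r.1 * auxRho (r.1 - s.1)) ^ 2 * auxRho s.2 ^ 2)
        * (auxRho (r.1 - s.1) * auxRho ((r.2:ℤ) - s.2)) := by ring
      _ ≤ |CG| * Ce * (|CT| * Cχ * S) * (auxRho s.1 ^ 2 * auxRho s.2 ^ 2)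
        * (auxRho (r.1 - s.1) * auxRho ((r.2:ℤ) - s.2)) := by gcongr
      _ = _ := by ring
end
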